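/- Let p > 3 be a prime and let R := a²f² − abef − 2acdf + ace² + b²df − bcde + c²d² ∈ 𝔽_p[a,b,c,d,e,f]. Then the number of points (a,b,c,d,e,f) ∈ 𝔽_p^6 at which R and all six of its partial derivatives ∂R/∂a, ∂R/∂b, ∂R/∂c, ∂R/∂d, ∂R/∂e, ∂R/∂f vanish is strictly less than p⁴ + 3p³. -/

import Mathlib

open Filter MvPolynomial

noncomputable section

/-- The `2d × 2d` Sylvester matrix of the two generic binary forms of degree `d`,
with entries taken from the coordinates of `Q` (the first `d+1` coordinates of `Q`
are the coefficients of `F`, the last `d+1` ones those of `G`). -/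
def sylvesterMat (d : ℕ) {R : Type*} [CommRing R] (Q : Fin (2 * d + 2) → R) :
    Matrix (Fin (2 * d)) (Fin (2 * d)) R :=
  Matrix.of fun i j =>
    if hi : (i : ℕ) < d then
      if h : (i : ℕ) ≤ (j : ℕ) ∧ (j : ℕ) ≤ (i : ℕ) + d then
        Q ⟨(j : ℕ) - (i : ℕ), by omega⟩
      else 0
    else
      if h : (i : ℕ) - d ≤ (j : ℕ) ∧ (j : ℕ) ≤ (i : ℕ) then
        Q ⟨d + 1 + ((j : ℕ) - ((i : ℕ) - d)), by omega⟩
      else 0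

/-- The generic resultant polynomial `𝔯 ∈ ℤ[x₀,…,x_d,y₀,…,y_d]`:
the determinant of the Sylvester matrix of the generic binary forms of degree `d`. -/
def resPoly (d : ℕ) : MvPolynomial (Fin (2 * d + 2)) ℤ :=
  Matrix.det (sylvesterMat d fun i => X i)

/-- Evaluation `𝔯(Q)` of the generic resultant at a tuple `Q` with entries in a
commutative ring (i.e. evaluation of the image of `𝔯` under the coefficient map `ℤ → R`). -/
def resEval (d : ℕ) {R : Type*} [CommRing R] (Q : Fin (2 * d + 2) → R) : R :=
  aeval Q (resPoly d)

/-- The set `𝒫 ⊆ ℤ^{2d+2}` identified with `ℙ^{2d+1}(ℚ)`: integer tuples with gcd `1`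
whose first nonzero coordinate is positive. -/
def projPts (d : ℕ) : Set (Fin (2 * d + 2) → ℤ) :=
  {C | Finset.univ.gcd C = 1 ∧ ∃ i, 0 < C i ∧ ∀ j, j < i → C j = 0}

/-- The box of integer tuples with `|xᵢ| ≤ rᵢ` for all `i`. -/
def box {m : ℕ} (r : Fin m → ℝ) : Set (Fin m → ℤ) :=
  {x | ∀ i, |(x i : ℝ)| ≤ r i}

/-- The value `ζ(k)` of the Riemann zeta function at an integer `k` (for `k ≥ 2`). -/
def zetaVal (k : ℕ) : ℝ := ∑' n : ℕ+, (1 : ℝ) / ((n : ℕ) : ℝ) ^ k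

/-- The local factor `π_p^{(k)}`. -/
def piLocal (d p k : ℕ) : ℝ :=
  (Nat.card {Q : Fin (2 * d + 2) → ZMod (p ^ k) // resEval d Q ≠ 0} : ℝ) /
    ((p : ℝ) ^ ((2 * d + 2) * k) * (1 - 1 / (p : ℝ) ^ (2 * d + 2)))

/-- The resultant `R = a²f² − abef − 2acdf + ace² + b²df − bcde + c²d²` of the generic
binary quadratic forms, as a polynomial in six variables over `𝔽_p`. -/
def quadRes (p : ℕ) : MvPolynomial (Fin 6) (ZMod p) :=
  (X 0) ^ 2 * (X 5) ^ 2 - X 0 * X 1 * X 4 * X 5 - 2 * (X 0 * X 2 * X 3 * X 5) +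
    X 0 * X 2 * (X 4) ^ 2 + (X 1) ^ 2 * X 3 * X 5 - X 1 * X 2 * X 3 * X 4 +
    (X 2) ^ 2 * (X 3) ^ 2

/-- At a common zero of the partial derivatives of the resultant, the maximal minors of the
`2 × 3` coefficient matrix vanish. -/
theorem minors_eq_zero_of_pderiv_quadRes_eq_zero {p : ℕ} (hp : p.Prime) (h2 : 2 < p)
    {v : Fin 6 → ZMod p} (hv : ∀ i : Fin 6, eval v (pderiv i (quadRes p)) = 0) :
    v 0 * v 4 = v 1 * v 3 ∧ v 0 * v 5 = v 2 * v 3 ∧ v 1 * v 5 = v 2 * v 4 := by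
  have := Fact.mk hp
  have two_ne : (2 : ZMod p) ≠ 0 := by
    intro h
    have : ((2 : ℕ) : ZMod p) = 0 := by exact_mod_cast h
    rw [ZMod.natCast_eq_zero_iff] at this
    exact absurd (Nat.le_of_dvd two_pos this) (by omega)
  have pderiv_two (i : Fin 6) : pderiv i (2 : MvPolynomial (Fin 6) (ZMod p)) = 0 := by
    simpa using (pderiv i).map_natCast 2
  have ha := hv 0
  have hb := hv 1
  have hc := hv 2
  have hd := hv 3
  have he := hv 4
  have hf := hv 5
  simp [quadRes, pderiv_X, pderiv_two, Derivation.leibniz_pow] at ha hb hc hd he hf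
  generalize v 0 = a at *
  generalize v 1 = b at *
  generalize v 2 = c at *
  generalize v 3 = d at *
  generalize v 4 = e at *
  generalize v 5 = f at *
  have h1 : a * e - b * d = 0 := by
    refine pow_eq_zero_iff two_ne_zero |>.mp ?_
    linear_combination a * hc + d * hf
  have h3 : b * f - c * e = 0 := by
    refine pow_eq_zero_iff two_ne_zero |>.mp ?_
    linear_combination f * hd + c * ha
  have h2 : a * f - c * d = 0 := by
    refine pow_eq_zero_iff two_ne_zero |>.mp ((mul_eq_zero.mp ?_).resolve_left two_ne)
    linear_combination f * hf + c * hc + (b * f - c * e) * h1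
  exact ⟨by linear_combination h1, by linear_combination h2, by linear_combination h3⟩

/-- for `p > 3`, the common zero locus over `𝔽_p` of `R` and all six of
its partial derivatives has fewer than `p⁴ + 3p³` points. -/
theorem stmt_18 (p : ℕ) (hp : p.Prime) (h3 : 3 < p) :
    Nat.card {v : Fin 6 → ZMod p //
        eval v (quadRes p) = 0 ∧ ∀ i : Fin 6, eval v (pderiv i (quadRes p)) = 0} <
      p ^ 4 + 3 * p ^ 3 := by
  have := Fact.mk hp
  let g : (ZMod p × (Fin 3 → ZMod p)) ⊕ (Fin 3 → ZMod p) → Fin 6 → ZMod p :=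
    Sum.elim (fun q => ![q.2 0, q.2 1, q.2 2, q.1 * q.2 0, q.1 * q.2 1, q.1 * q.2 2])
      (fun y => ![0, 0, 0, y 0, y 1, y 2])
  have hsub : {v : Fin 6 → ZMod p |
      eval v (quadRes p) = 0 ∧ ∀ i : Fin 6, eval v (pderiv i (quadRes p)) = 0} ⊆ Set.range g := by
    rintro v ⟨-, hv⟩
    obtain ⟨h1, h2, h3⟩ := minors_eq_zero_of_pderiv_quadRes_eq_zero hp (by omega) hv
    by_cases ha : v 0 = 0
    · by_cases hb : v 1 = 0
      · by_cases hc : v 2 = 0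
        · refine ⟨.inr ![v 3, v 4, v 5], ?_⟩
          ext i
          fin_cases i <;> simp [g, ha, hb, hc]
        · refine ⟨.inl (v 5 / v 2, ![v 0, v 1, v 2]), ?_⟩
          ext i
          fin_cases i <;> simp [g] <;> field_simp <;> grind
      · refine ⟨.inl (v 4 / v 1, ![v 0, v 1, v 2]), ?_⟩
        ext i
        fin_cases i <;> simp [g] <;> field_simp <;> grind
    · refine ⟨.inl (v 3 / v 0, ![v 0, v 1, v 2]), ?_⟩
      ext i
      fin_cases i <;> simp [g] <;> field_simp <;> grind
  calc _ ≤ Nat.card (Set.range g) := Nat.card_mono (Set.toFinite _) hsub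
    _ ≤ Nat.card ((ZMod p × (Fin 3 → ZMod p)) ⊕ (Fin 3 → ZMod p)) := Finite.card_range_le g
    _ = p ^ 4 + p ^ 3 := by simp [Nat.card_eq_fintype_card, ZMod.card]; ring
    _ < p ^ 4 + 3 * p ^ 3 := by have := pow_pos hp.pos 3; omega
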